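/- Let u ∈ {0,1}^ℕ contain at least two ones. Then there exists a unique m ∈ (1,2] with f_u(m) = g_u(m); i.e. the quantity μ_u is well defined. -/

import Mathlib

/-- `π_β(u)` for a binary sequence `u = u₁u₂⋯` (indexed from 0). -/
noncomputable def piB (β : ℝ) (u : ℕ → Bool) : ℝ :=
  ∑' k : ℕ, (if u k then (1 : ℝ) else 0) / β ^ (k + 1)

/-- `π_β(u)` for a real digit sequence. -/
noncomputable def piR (β : ℝ) (u : ℕ → ℝ) : ℝ := ∑' k : ℕ, u k / β ^ (k + 1)

/-- A binary sequence viewed as a real digit sequence. -/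
def bR (u : ℕ → Bool) : ℕ → ℝ := fun k => if u k then 1 else 0

/-- `U_β(A)`: sequences with digits in `A` whose `π_β`-value has no other expansion over `A`. -/
def Uset (β : ℝ) (A : Set ℝ) : Set (ℕ → ℝ) :=
  {u | (∀ k, u k ∈ A) ∧ ∀ v : ℕ → ℝ, (∀ k, v k ∈ A) → v ≠ u → piR β v ≠ piR β u}

/-- `𝓛(m) = inf {β > 1 : U_β(m) ∩ {0,1}^ℕ is uncountable}`. -/
noncomputable def Lval (m : ℝ) : ℝ :=
  sInf {β : ℝ | 1 < β ∧ ¬ (Uset β {0, 1, m} ∩ {v | ∃ u : ℕ → Bool, v = bR u}).Countable}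

/-- The shift orbit `O(u)` of an infinite binary word. -/
def orbit (u : ℕ → Bool) : Set (ℕ → Bool) := {v | ∃ k : ℕ, v = fun i => u (i + k)}

/-- Suffixes of `u` preceded by the letter `1`. -/
def orbit1 (u : ℕ → Bool) : Set (ℕ → Bool) :=
  {v | ∃ k : ℕ, u k = true ∧ v = fun i => u (i + k + 1)}

/-- Suffixes of `u` preceded by the letter `0`. -/
def orbit0 (u : ℕ → Bool) : Set (ℕ → Bool) :=
  {v | ∃ k : ℕ, u k = false ∧ v = fun i => u (i + k + 1)}

open Classical in
/-- The lexicographic supremum of a set of binary sequences (greedy construction);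
`⊥ = 0̄` for the empty set. -/
noncomputable def lexSupSeq (S : Set (ℕ → Bool)) : ℕ → Bool
  | n => decide (∃ u ∈ S, (∀ i, i < n → u i = lexSupSeq S i) ∧ u n = true)
  termination_by n => n

open Classical in
/-- The lexicographic infimum of a set of binary sequences (greedy construction);
`⊤ = 1̄` for the empty set. -/
noncomputable def lexInfSeq (S : Set (ℕ → Bool)) : ℕ → Bool
  | n => decide (¬ ∃ u ∈ S, (∀ i, i < n → u i = lexInfSeq S i) ∧ u n = false)
  termination_by n => n

/-- `sup O(u)`, the lexicographically largest limit of suffixes of `u`. -/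
noncomputable def supO (u : ℕ → Bool) : ℕ → Bool := lexSupSeq (orbit u)
/-- `inf O(u)`. -/
noncomputable def infO (u : ℕ → Bool) : ℕ → Bool := lexInfSeq (orbit u)
/-- `sup₀(u)`, the supremum of the suffixes preceded by `0`. -/
noncomputable def sup0 (u : ℕ → Bool) : ℕ → Bool := lexSupSeq (orbit0 u)
/-- `inf₁(u)`, the infimum of the suffixes preceded by `1`. -/
noncomputable def inf1 (u : ℕ → Bool) : ℕ → Bool := lexInfSeq (orbit1 u)

/-- Strict lexicographic order on infinite binary words. -/
def lexLt (u v : ℕ → Bool) : Prop := ∃ n, (∀ i, i < n → u i = v i) ∧ u n < v n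
/-- Lexicographic order on infinite binary words. -/
def lexLe (u v : ℕ → Bool) : Prop := lexLt u v ∨ u = v

/-- `f_u(m)`: the unique `β ≥ 1` with `β·π_β(sup O(u)) = m`. -/
noncomputable def fVal (u : ℕ → Bool) (m : ℝ) : ℝ :=
  sInf {β : ℝ | 1 ≤ β ∧ β * piB β (supO u) = m}

/-- `g_u(m)`: the unique `β > 1` with `(β-1)(1+π_β(inf O(u))) = m`. -/
noncomputable def gVal (u : ℕ → Bool) (m : ℝ) : ℝ :=
  sInf {β : ℝ | 1 < β ∧ (β - 1) * (1 + piB β (infO u)) = m}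

/-- `μ_u`: the unique `m ∈ (1,2]` with `f_u(m) = g_u(m)`. -/
noncomputable def muVal (u : ℕ → Bool) : ℝ :=
  sInf {m : ℝ | 1 < m ∧ m ≤ 2 ∧ fVal u m = gVal u m}

/-- `u` contains at least two ones. -/
def TwoOnes (u : ℕ → Bool) : Prop := ∃ k l, k < l ∧ u k = true ∧ u l = true

/-- The substitution `L : 0 ↦ 0, 1 ↦ 01` (with `0 = false`, `1 = true`). -/
def Lsub : Bool → List Bool := fun b => if b then [false, true] else [false]
/-- The substitution `M : 0 ↦ 01, 1 ↦ 10`. -/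
def Msub : Bool → List Bool := fun b => if b then [true, false] else [false, true]
/-- The substitution `R : 0 ↦ 01, 1 ↦ 1`. -/
def Rsub : Bool → List Bool := fun b => if b then [true] else [false, true]
/-- The identity substitution. -/
def idSub : Bool → List Bool := fun b => [b]
/-- Composition of substitutions: `compSub σ τ = σ ∘ τ` (apply `τ` first). -/
def compSub (σ τ : Bool → List Bool) : Bool → List Bool := fun b => (τ b).flatMap σ

/-- The monoid `{L,M,R}*` generated by the three substitutions. -/
def LMRstar : Set (Bool → List Bool) :=
  {σ | ∃ l : List (Bool → List Bool),
    (∀ τ ∈ l, τ = Lsub ∨ τ = Msub ∨ τ = Rsub) ∧ σ = l.foldr compSub idSub}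

/-- A substitution applied to an infinite word, `σ(u₁)σ(u₂)⋯`. -/
noncomputable def substApply (σ : Bool → List Bool) (u : ℕ → Bool) : ℕ → Bool := fun n =>
  let k := sSup {k : ℕ | (∑ i ∈ Finset.range k, (σ (u i)).length) ≤ n}
  (σ (u k)).getD (n - ∑ i ∈ Finset.range k, (σ (u i)).length) false

/-- `u` is a limit word of the sequence of substitutions `σseq`. -/
def IsLimitWord (σseq : ℕ → Bool → List Bool) (u : ℕ → Bool) : Prop :=
  ∃ useq : ℕ → ℕ → Bool, useq 0 = u ∧ ∀ n, useq n = substApply (σseq n) (useq (n + 1))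

/-- Primitivity of a sequence of substitutions in `{L,M,R}^ℕ`: no tail is constantly `L`
and no tail is constantly `R`. -/
def PrimitiveSeq (σseq : ℕ → Bool → List Bool) : Prop :=
  (¬ ∃ k, ∀ n, k ≤ n → σseq n = Lsub) ∧ ¬ ∃ k, ∀ n, k ≤ n → σseq n = Rsub

/-- `S_{L,M,R}`: the set of limit words of primitive sequences of substitutions. -/
def Sset : Set (ℕ → Bool) :=
  {u | ∃ σseq : ℕ → Bool → List Bool,
    (∀ n, σseq n = Lsub ∨ σseq n = Msub ∨ σseq n = Rsub) ∧
    PrimitiveSeq σseq ∧ IsLimitWord σseq u}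

/-- The word `1 0̄ = 1000⋯`. -/
def w10bar : ℕ → Bool := fun n => decide (n = 0)
/-- The word `0 1̄ = 0111⋯`. -/
def w01bar : ℕ → Bool := fun n => decide (n ≠ 0)
/-- The word `01 0̄ = 01000⋯`. -/
def w010bar : ℕ → Bool := fun n => decide (n = 1)
/-- The word `10 1̄ = 10111⋯`. -/
def w101bar : ℕ → Bool := fun n => decide (n ≠ 1)
/-- The word `0̄`. -/
def w0bar : ℕ → Bool := fun _ => false
/-- The word `1̄`. -/
def w1bar : ℕ → Bool := fun _ => true

/-- Prepend a letter to an infinite word. -/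
def consB (b : Bool) (u : ℕ → Bool) : ℕ → Bool := fun n =>
  match n with
  | 0 => b
  | Nat.succ k => u k

/-- Prepend a finite word to an infinite word. -/
def appendW (w : List Bool) (v : ℕ → Bool) : ℕ → Bool := fun n =>
  if n < w.length then w.getD n false else v (n - w.length)

lemma piB_term_nonneg {β : ℝ} (hβ : 1 ≤ β) (u : ℕ → Bool) (k : ℕ) :
    0 ≤ (if u k then (1 : ℝ) else 0) / β ^ (k + 1) := by
  have : 0 < β := by linarith
  split_ifs <;> positivity

lemma piB_term_le {β : ℝ} (hβ : 1 ≤ β) (u : ℕ → Bool) (k : ℕ) :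
    (if u k then (1 : ℝ) else 0) / β ^ (k + 1) ≤ 1 / β ^ (k + 1) := by
  have : 0 < β := by linarith
  gcongr
  split_ifs <;> norm_num

lemma piB_term_anti {β γ : ℝ} (hβ : 1 ≤ β) (h : β ≤ γ) (u : ℕ → Bool) (k : ℕ) :
    (if u k then (1 : ℝ) else 0) / γ ^ (k + 1) ≤ (if u k then (1 : ℝ) else 0) / β ^ (k + 1) := by
  have : 0 < β := by linarith
  gcongr

lemma hasSum_one_div_pow_succ {β : ℝ} (hβ : 1 < β) :
    HasSum (fun k : ℕ => 1 / β ^ (k + 1)) (1 / (β - 1)) := by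
  have h0 : 0 < β := by linarith
  have h := (hasSum_geometric_of_lt_one (r := β⁻¹) (by positivity)
    (inv_lt_one_of_one_lt₀ hβ)).mul_left β⁻¹
  have h1 : β - 1 ≠ 0 := by linarith
  have e : β⁻¹ * (1 - β⁻¹)⁻¹ = 1 / (β - 1) := by
    rw [← mul_inv, mul_sub, mul_one, mul_inv_cancel₀ h0.ne', one_div]
  rw [e] at h
  refine (funext fun k => ?_ : (fun k : ℕ => 1 / β ^ (k + 1)) = fun k => β⁻¹ * β⁻¹ ^ k) ▸ h
  rw [pow_succ', one_div, mul_inv, inv_pow]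

lemma summable_piB {β : ℝ} (hβ : 1 < β) (u : ℕ → Bool) :
    Summable fun k : ℕ => (if u k then (1 : ℝ) else 0) / β ^ (k + 1) :=
  Summable.of_nonneg_of_le (piB_term_nonneg hβ.le u) (piB_term_le hβ.le u)
    (hasSum_one_div_pow_succ hβ).summable

lemma piB_nonneg {β : ℝ} (hβ : 1 ≤ β) (u : ℕ → Bool) : 0 ≤ piB β u :=
  tsum_nonneg (piB_term_nonneg hβ u)

lemma piB_le {β : ℝ} (hβ : 1 < β) (u : ℕ → Bool) : piB β u ≤ 1 / (β - 1) := by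
  rw [← (hasSum_one_div_pow_succ hβ).tsum_eq]
  exact (summable_piB hβ u).tsum_le_tsum (piB_term_le hβ.le u)
    (hasSum_one_div_pow_succ hβ).summable

lemma piB_add_piB_not {β : ℝ} (hβ : 1 < β) (u : ℕ → Bool) :
    piB β u + piB β (fun k => !u k) = 1 / (β - 1) := by
  rw [← (hasSum_one_div_pow_succ hβ).tsum_eq, piB, piB,
    ← (summable_piB hβ u).tsum_add (summable_piB hβ _)]
  refine tsum_congr fun k => ?_
  cases u k <;> simp

lemma piB_anti {β γ : ℝ} (hβ : 1 < β) (h : β ≤ γ) (u : ℕ → Bool) : piB γ u ≤ piB β u :=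
  (summable_piB (hβ.trans_le h) u).tsum_le_tsum (piB_term_anti hβ.le h u) (summable_piB hβ u)

lemma continuousOn_piB {β : ℝ} (hβ : 1 < β) (u : ℕ → Bool) :
    ContinuousOn (fun γ => piB γ u) (Set.Ici β) := by
  unfold piB
  refine continuousOn_tsum (u := fun k => 1 / β ^ (k + 1)) (fun k => ?_)
    (hasSum_one_div_pow_succ hβ).summable fun k γ hγ => ?_
  · refine continuousOn_const.div (by fun_prop) fun γ hγ => ?_
    have : 0 < γ := by linarith [Set.mem_Ici.1 hγ]
    positivity
  · have hγ' : β ≤ γ := hγ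
    rw [Real.norm_of_nonneg (piB_term_nonneg (by linarith) u k)]
    exact (piB_term_anti hβ.le hγ' u k).trans (piB_term_le hβ.le u k)

/-- For a word with first letter `1` and a further `1`, the map `β ↦ β π_β` is strictly
decreasing wherever it takes a nonzero value (at `β = 1` the series may diverge). -/
lemma mul_piB_lt {β γ : ℝ} (hβ : 1 ≤ β) (h : β < γ) {a : ℕ → Bool} {j : ℕ} (hj : 1 ≤ j)
    (haj : a j = true) (hne : β * piB β a ≠ 0) : γ * piB γ a < β * piB β a := by
  have hβ0 : 0 < β := by linarith
  have hγ0 : 0 < γ := by linarith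
  have hs : Summable fun k : ℕ => (if a k then (1 : ℝ) else 0) / β ^ (k + 1) := by
    by_contra hs
    exact hne (by rw [piB, tsum_eq_zero_of_not_summable hs, mul_zero])
  have hs' := summable_piB (hβ.trans_lt h) a
  have key : ∀ {δ : ℝ}, 0 < δ → ∀ k : ℕ, δ * ((if a k then (1 : ℝ) else 0) / δ ^ (k + 1)) =
      (if a k then (1 : ℝ) else 0) / δ ^ k := by
    intro δ hδ k
    rw [pow_succ]
    field_simp
  rw [piB, piB, ← tsum_mul_left, ← tsum_mul_left]
  refine Summable.tsum_lt_tsum (i := j) (fun k => ?_) ?_ (hs'.mul_left γ) (hs.mul_left β)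
  · rw [key hγ0, key hβ0]
    gcongr
  · rw [key hγ0, key hβ0, haj, if_pos rfl]
    have : β ^ j < γ ^ j := pow_lt_pow_left₀ h hβ0.le (by omega)
    gcongr

lemma le_mul_piB {β : ℝ} (hβ : 1 < β) {a : ℕ → Bool} {j : ℕ} (hj : 1 ≤ j)
    (ha0 : a 0 = true) (haj : a j = true) : 1 + 1 / β ^ j ≤ β * piB β a := by
  have h0 : 0 < β := by linarith
  have h := (summable_piB hβ a).sum_le_tsum {0, j} fun k _ => piB_term_nonneg hβ.le a k
  rw [Finset.sum_pair (by omega), ha0, haj] at h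
  calc 1 + 1 / β ^ j = β * (1 / β ^ (0 + 1) + 1 / β ^ (j + 1)) := by
        rw [zero_add, pow_one, pow_succ β j]
        field_simp
    _ ≤ β * piB β a := by
        gcongr
        simpa [piB] using h

lemma sub_one_mul_lt {β γ : ℝ} (hβ : 1 < β) (h : β < γ) (b : ℕ → Bool)
    (hm : 1 < (γ - 1) * (1 + piB γ b)) :
    (β - 1) * (1 + piB β b) < (γ - 1) * (1 + piB γ b) := by
  have hγ : 1 < γ := hβ.trans h
  have h1 := piB_add_piB_not hβ b
  have h2 := piB_add_piB_not hγ b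
  have h3 := piB_anti hβ h.le fun k => !b k
  set P := piB β b
  set Q := piB γ b
  set P' := piB β fun k => !b k
  set Q' := piB γ fun k => !b k
  have hβ1 : 0 < β - 1 := by linarith
  have hγ1 : 0 < γ - 1 := by linarith
  have e1 : (β - 1) * P = 1 - (β - 1) * P' := by
    rw [eq_sub_iff_add_eq, ← mul_add, h1]; field_simp
  have e2 : (γ - 1) * Q = 1 - (γ - 1) * Q' := by
    rw [eq_sub_iff_add_eq, ← mul_add, h2]; field_simp
  have hQ : 0 < 1 - Q' := by
    have : 0 < (γ - 1) * (1 - Q') := by linarith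
    exact (pos_iff_pos_of_mul_pos this).1 hγ1
  have : (β - 1) * (1 - P') ≤ (β - 1) * (1 - Q') := by gcongr
  have : (β - 1) * (1 - Q') < (γ - 1) * (1 - Q') := by gcongr
  linarith

lemma sub_one_mul_le {β : ℝ} (hβ : 1 < β) (b : ℕ → Bool) : (β - 1) * (1 + piB β b) ≤ β := by
  have h := piB_le hβ b
  have h1 : 0 < β - 1 := by linarith
  rw [le_div_iff₀ h1] at h
  linarith

lemma exists_sub_one_mul_eq {m : ℝ} (hm : 1 < m) (hm' : m ≤ 2) (b : ℕ → Bool) :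
    ∃ β : ℝ, 1 < β ∧ (β - 1) * (1 + piB β b) = m := by
  have h1 : 1 < (1 + m) / 2 := by linarith
  have hc : ContinuousOn (fun β => (β - 1) * (1 + piB β b)) (Set.Icc ((1 + m) / 2) 3) :=
    (continuousOn_id.sub continuousOn_const).mul (continuousOn_const.add
      ((continuousOn_piB h1 b).mono Set.Icc_subset_Ici_self))
  have h3 := piB_nonneg (β := 3) (by norm_num) b
  obtain ⟨β, hβ, e⟩ := intermediate_value_Icc (by linarith) hc
    (show m ∈ Set.Icc _ _ from ⟨(sub_one_mul_le h1 b).trans (by linarith), by linarith⟩)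
  exact ⟨β, h1.trans_le hβ.1, e⟩

lemma gVal_eq {u : ℕ → Bool} {m β : ℝ} (hm : 1 < m) (hβ : 1 < β)
    (h : (β - 1) * (1 + piB β (infO u)) = m) : gVal u m = β := by
  suffices e : {β : ℝ | 1 < β ∧ (β - 1) * (1 + piB β (infO u)) = m} = {β} by
    rw [gVal, e, csInf_singleton]
  ext γ
  refine ⟨fun ⟨hγ, hγm⟩ => ?_, fun hγ => by rw [Set.mem_singleton_iff.1 hγ]; exact ⟨hβ, h⟩⟩
  rcases lt_trichotomy γ β with hlt | heq | hlt
  · linarith [sub_one_mul_lt hγ hlt (infO u) (by linarith)]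
  · exact heq
  · linarith [sub_one_mul_lt hβ hlt (infO u) (by linarith)]

lemma fVal_eq {u : ℕ → Bool} {j : ℕ} (hj : 1 ≤ j) (haj : supO u j = true) {m β : ℝ}
    (hm : 1 < m) (hβ : 1 ≤ β) (h : β * piB β (supO u) = m) : fVal u m = β := by
  suffices e : {β : ℝ | 1 ≤ β ∧ β * piB β (supO u) = m} = {β} by
    rw [fVal, e, csInf_singleton]
  ext γ
  refine ⟨fun ⟨hγ, hγm⟩ => ?_, fun hγ => by rw [Set.mem_singleton_iff.1 hγ]; exact ⟨hβ, h⟩⟩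
  rcases lt_trichotomy γ β with hlt | heq | hlt
  · linarith [mul_piB_lt hγ hlt hj haj (by linarith)]
  · exact heq
  · linarith [mul_piB_lt hβ hlt hj haj (by linarith)]

open Classical in
lemma lexSupSeq_eq_true {S : Set (ℕ → Bool)} {v : ℕ → Bool} (hv : v ∈ S) {n : ℕ}
    (h : ∀ i < n, v i = lexSupSeq S i) (hn : v n = true) : lexSupSeq S n = true := by
  rw [lexSupSeq, decide_eq_true_eq]
  exact ⟨v, hv, h, hn⟩

lemma supO_of_twoOnes {u : ℕ → Bool} (hu : TwoOnes u) :
    supO u 0 = true ∧ ∃ j, 1 ≤ j ∧ supO u j = true := by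
  obtain ⟨k, l, hkl, hk, hl⟩ := hu
  have hv : (fun i => u (i + k)) ∈ orbit u := ⟨k, rfl⟩
  have h0 : supO u 0 = true := lexSupSeq_eq_true hv (by simp) (by simpa using hk)
  refine ⟨h0, ?_⟩
  by_contra! hne
  have agree : ∀ i, u (i + k) = supO u i := by
    intro i
    induction i using Nat.strong_induction_on with
    | _ i ih =>
      rcases Nat.eq_zero_or_pos i with rfl | hi
      · simpa [h0] using hk
      · have hf := hne i hi
        rcases hui : u (i + k) with _ | _
        · simpa using hf
        · exact absurd (lexSupSeq_eq_true hv ih hui) hf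
  refine hne (l - k) (by omega) ?_
  rw [← agree, Nat.sub_add_cancel hkl.le, hl]

lemma exists_mul_piB_eq {a : ℕ → Bool} (b : ℕ → Bool) {j : ℕ} (hj : 1 ≤ j)
    (ha0 : a 0 = true) (haj : a j = true) :
    ∃ β : ℝ, 1 < β ∧ β * piB β a = (β - 1) * (1 + piB β b) := by
  set β₀ : ℝ := 1 + 1 / 2 ^ j with hβ₀
  have hp : (0 : ℝ) < 1 / 2 ^ j := by positivity
  have h1 : 1 < β₀ := by linarith
  have h2 : β₀ ≤ 2 := by
    have : (1 : ℝ) / 2 ^ j ≤ 1 := by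
      rw [div_le_one (by positivity)]
      exact one_le_pow₀ (by norm_num)
    linarith
  have hlow : β₀ ≤ β₀ * piB β₀ a := by
    refine le_trans ?_ (le_mul_piB h1 hj ha0 haj)
    conv_lhs => rw [hβ₀]
    gcongr
  have hsub : Set.Icc β₀ 3 ⊆ Set.Ici β₀ := Set.Icc_subset_Ici_self
  have ha := (continuousOn_piB h1 a).mono hsub
  have hb := (continuousOn_piB h1 b).mono hsub
  have hc : ContinuousOn (fun β => (β - 1) * (1 + piB β b) - β * piB β a) (Set.Icc β₀ 3) :=
    ((continuousOn_id.sub continuousOn_const).mul (continuousOn_const.add hb)).sub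
      (continuousOn_id.mul ha)
  have h3 := piB_nonneg (β := 3) (by norm_num) b
  have h3' := piB_le (β := 3) (by norm_num) a
  obtain ⟨β, hβ, e⟩ := intermediate_value_Icc (by linarith) hc
    (show (0 : ℝ) ∈ Set.Icc _ _ from
      ⟨by linarith [sub_one_mul_le h1 b], by norm_num at h3'; linarith⟩)
  exact ⟨β, h1.trans_le hβ.1, (sub_eq_zero.1 e).symm⟩

/-- `μ_u` is well defined: there is a unique `m ∈ (1,2]` with `f_u(m) = g_u(m)`. -/
theorem mu_well_defined (u : ℕ → Bool) (hu : TwoOnes u) :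
    ∃! m : ℝ, 1 < m ∧ m ≤ 2 ∧ fVal u m = gVal u m := by
  obtain ⟨h0, j, hj, haj⟩ := supO_of_twoOnes hu
  obtain ⟨β, hβ, e⟩ := exists_mul_piB_eq (infO u) hj h0 haj
  have hm1 : 1 < β * piB β (supO u) := by
    have : 0 < 1 / β ^ j := by positivity
    linarith [le_mul_piB hβ hj h0 haj]
  refine ⟨β * piB β (supO u), ⟨hm1, ?_, ?_⟩, ?_⟩
  · rcases le_total β 2 with h | h
    · exact e.trans_le ((sub_one_mul_le hβ _).trans h)
    · have h1 := piB_le hβ (supO u)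
      rw [le_div_iff₀ (by linarith)] at h1
      have := mul_nonneg (piB_nonneg hβ.le (supO u)) (sub_nonneg.2 h)
      linarith
  · rw [fVal_eq hj haj hm1 hβ.le rfl, gVal_eq hm1 hβ e.symm]
  · rintro m ⟨hm, hm2, hfg⟩
    obtain ⟨γ, hγ, hg⟩ := exists_sub_one_mul_eq hm hm2 (infO u)
    rw [gVal_eq hm hγ hg] at hfg
    have hf : γ * piB γ (supO u) = m := by
      rcases Set.eq_empty_or_nonempty {β : ℝ | 1 ≤ β ∧ β * piB β (supO u) = m} with h | h
      · rw [fVal, h, Real.sInf_empty] at hfg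
        linarith
      · obtain ⟨δ, hδ, hδm⟩ := h
        rw [← hfg, fVal_eq hj haj hm hδ hδm, hδm]
    rcases lt_trichotomy γ β with h | h | h
    · linarith [mul_piB_lt hγ.le h hj haj (by linarith),
        sub_one_mul_lt hγ h (infO u) (by linarith)]
    · rw [← hf, h]
    · linarith [mul_piB_lt hβ.le h hj haj (by linarith),
        sub_one_mul_lt hβ h (infO u) (by linarith)]
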